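/- The function T ↦ ∫_0^T F_1(t) dt satisfies ∫_0^T F_1(t) dt = Ω_±(T^{3/4}); that is, limsup_{T→∞} T^{−3/4} ∫_0^T F_1(t) dt > 0 and liminf_{T→∞} T^{−3/4} ∫_0^T F_1(t) dt < 0. -/

import Mathlib

open MeasureTheory

/-- `K(x) = 2π` for `1/4 < x < 3/4` and `K(x) = 0` otherwise. -/
noncomputable def Kfun (x : ℝ) : ℝ := if 1 / 4 < x ∧ x < 3 / 4 then 2 * Real.pi else 0

/-- `F₁(T) = (T/(2π))^{1/4} (-1)^{⌊√(T/(2π))⌋} K({√(T/(2π))})`. -/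
noncomputable def F1 (T : ℝ) : ℝ :=
  (T / (2 * Real.pi)) ^ ((1 : ℝ) / 4) * (-1 : ℝ) ^ ⌊Real.sqrt (T / (2 * Real.pi))⌋ *
    Kfun (Int.fract (Real.sqrt (T / (2 * Real.pi))))

/-- The sign-alternating square wave `(-1)^⌊x⌋ K({x})`. -/
noncomputable def squareWave (x : ℝ) : ℝ := (-1 : ℝ) ^ ⌊x⌋ * Kfun (Int.fract x)

/-- The primitive of `y ↦ y^{3/2} (-1)^⌊y⌋ K({y})` vanishing at `0`. -/
noncomputable def wavePrimitive (Y : ℝ) : ℝ := ∫ y in (0 : ℝ)..Y, y * √y * squareWave y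

/-- The absolute value of the integral of `y ↦ y^{3/2} (-1)^⌊y⌋ K({y})` over `[n, n + 1]`. -/
noncomputable def blockIntegral (n : ℕ) : ℝ :=
  ∫ u in (0 : ℝ)..1, (u + n) * √(u + n) * squareWave u

lemma measurable_Kfun : Measurable Kfun :=
  Measurable.ite (measurableSet_Ioo (a := (1 / 4 : ℝ)) (b := 3 / 4)) measurable_const
    measurable_const

lemma Kfun_nonneg (x : ℝ) : 0 ≤ Kfun x := by
  unfold Kfun; split_ifs <;> positivity

lemma Kfun_le (x : ℝ) : Kfun x ≤ 2 * Real.pi := by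
  unfold Kfun; split_ifs
  · exact le_rfl
  · positivity

lemma measurable_squareWave : Measurable squareWave :=
  ((measurable_from_top (f := fun k : ℤ => (-1 : ℝ) ^ k)).comp Int.measurable_floor).mul
    (measurable_Kfun.comp measurable_fract)

lemma abs_squareWave_le (x : ℝ) : |squareWave x| ≤ 2 * Real.pi := by
  rw [squareWave, abs_mul, abs_zpow, abs_neg, abs_one, one_zpow, one_mul,
    abs_of_nonneg (Kfun_nonneg _)]
  exact Kfun_le _

lemma squareWave_add_natCast (x : ℝ) (n : ℕ) :
    squareWave (x + n) = (-1) ^ n * squareWave x := by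
  rw [squareWave, squareWave, Int.floor_add_natCast, Int.fract_add_natCast,
    zpow_add₀ (by norm_num), zpow_natCast]
  ring

lemma squareWave_nonneg {x : ℝ} (hx : x ∈ Set.Icc (0 : ℝ) 1) : 0 ≤ squareWave x := by
  rcases hx.2.eq_or_lt with rfl | h1
  · norm_num [squareWave, Kfun]
  · rw [squareWave, Int.floor_eq_zero_iff.2 ⟨hx.1, h1⟩]
    simpa using Kfun_nonneg _

lemma squareWave_pos {x : ℝ} (hx : x ∈ Set.Ioo (1 / 4 : ℝ) (3 / 4)) : 0 < squareWave x := by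
  have h : x ∈ Set.Ico (0 : ℝ) 1 := ⟨by linarith [hx.1], by linarith [hx.2]⟩
  rw [squareWave, Int.floor_eq_zero_iff.2 h, Int.fract_eq_self.2 h, Kfun, if_pos ⟨hx.1, hx.2⟩]
  simp [Real.pi_pos]

lemma intervalIntegrable_mul_squareWave {f : ℝ → ℝ} (hf : Continuous f) (a b : ℝ) :
    IntervalIntegrable (fun x => f x * squareWave x) volume a b := by
  have hb (s : Set ℝ) := Filter.Eventually.of_forall (f := ae (volume.restrict s))
    fun x => (Real.norm_eq_abs _).trans_le (abs_squareWave_le x)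
  have h := hf.intervalIntegrable (μ := volume) a b
  exact ⟨h.1.mul_bdd measurable_squareWave.aestronglyMeasurable (hb _),
    h.2.mul_bdd measurable_squareWave.aestronglyMeasurable (hb _)⟩

lemma integral_squareWave_pos : 0 < ∫ u in (0 : ℝ)..1, squareWave u := by
  have hi (a b : ℝ) : IntervalIntegrable squareWave volume a b := by
    simpa using intervalIntegrable_mul_squareWave (continuous_const (y := (1 : ℝ))) a b
  calc 0 < ∫ u in (1 / 4 : ℝ)..(3 / 4), squareWave u :=
        intervalIntegral.intervalIntegral_pos_of_pos_on (hi _ _) (fun x hx => squareWave_pos hx)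
          (by norm_num)
    _ ≤ _ := intervalIntegral.integral_mono_interval (by norm_num) (by norm_num) (by norm_num)
        ((ae_restrict_iff' measurableSet_Ioc).2 (Filter.Eventually.of_forall fun x hx =>
          squareWave_nonneg ⟨hx.1.le, hx.2⟩)) (hi _ _)

lemma continuous_shifted_mul_sqrt (c : ℝ) : Continuous fun u : ℝ => (u + c) * √(u + c) := by
  fun_prop

lemma wavePrimitive_add_one (n : ℕ) :
    wavePrimitive (n + 1 : ℕ) = wavePrimitive n + (-1) ^ n * blockIntegral n := by
  have hi (a b : ℝ) := intervalIntegrable_mul_squareWave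
    (f := fun y => y * √y) (by fun_prop) a b
  have h := intervalIntegral.integral_comp_add_right (a := 0) (b := 1)
    (fun y : ℝ => y * √y * squareWave y) (n : ℝ)
  rw [wavePrimitive, wavePrimitive,
    ← intervalIntegral.integral_add_adjacent_intervals (hi 0 n) (hi n _), blockIntegral,
    ← intervalIntegral.integral_const_mul]
  congr 1
  rw [zero_add, add_comm 1] at h
  rw [Nat.cast_add_one, ← h]
  refine intervalIntegral.integral_congr fun u _ => ?_
  simp only [squareWave_add_natCast]
  ring

lemma blockIntegral_nonneg (n : ℕ) : 0 ≤ blockIntegral n :=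
  intervalIntegral.integral_nonneg zero_le_one fun u hu => by
    have := squareWave_nonneg hu
    have := hu.1
    positivity

lemma sqrt_add_one_le (x : ℝ) (hx : 0 ≤ x) : √(x + 1) ≤ (x + 1) * √(x + 1) - x * √x := by
  nlinarith [Real.sqrt_le_sqrt (by linarith : x ≤ x + 1)]

lemma blockIntegral_step (n : ℕ) :
    √(n + 1) * ∫ u in (0 : ℝ)..1, squareWave u ≤ blockIntegral (n + 1) - blockIntegral n := by
  have hi (m : ℕ) := intervalIntegrable_mul_squareWave (continuous_shifted_mul_sqrt (m : ℝ)) 0 1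
  rw [blockIntegral, blockIntegral, ← intervalIntegral.integral_sub (hi _) (hi _),
    ← intervalIntegral.integral_const_mul]
  refine intervalIntegral.integral_mono_on zero_le_one
    (intervalIntegrable_mul_squareWave continuous_const _ _) ((hi _).sub (hi _)) fun u hu => ?_
  rw [← sub_mul]
  refine mul_le_mul_of_nonneg_right ?_ (squareWave_nonneg hu)
  have h := sqrt_add_one_le (u + n) (by have := hu.1; positivity)
  push_cast
  rw [← add_assoc]
  exact (Real.sqrt_le_sqrt (by linarith [hu.1])).trans h

lemma abs_integral_mul_squareWave_le {a b : ℝ} (ha : 0 ≤ a) (hab : a ≤ b) (hb : b ≤ a + 1) :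
    |∫ y in a..b, y * √y * squareWave y| ≤ 2 * Real.pi * (b * √b) := by
  have h := intervalIntegral.norm_integral_le_of_norm_le_const (a := a) (b := b)
    (f := fun y => y * √y * squareWave y) (C := 2 * Real.pi * (b * √b)) fun y hy => by
      rw [Set.uIoc_of_le hab] at hy
      have hy0 : 0 ≤ y := ha.trans hy.1.le
      rw [norm_mul, mul_comm, Real.norm_eq_abs, Real.norm_eq_abs,
        abs_of_nonneg (by positivity : 0 ≤ y * √y)]
      exact mul_le_mul (abs_squareWave_le y)
        (mul_le_mul hy.2 (Real.sqrt_le_sqrt hy.2) (by positivity) (by linarith))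
        (by positivity) (by positivity)
  refine h.trans (mul_le_of_le_one_right ?_ ?_)
  · have : 0 ≤ b := ha.trans hab
    positivity
  · rw [abs_of_nonneg (by linarith)]; linarith

lemma neg_one_pow_mul_self (n : ℕ) : (-1 : ℝ) ^ n * (-1) ^ n = 1 := by
  rw [← mul_pow]; norm_num

lemma wavePrimitive_zero : wavePrimitive 0 = 0 := by simp [wavePrimitive]

lemma signed_wavePrimitive_succ (n : ℕ) :
    (-1) ^ n * wavePrimitive (n + 1 : ℕ) =
      blockIntegral n + (-1) ^ n * wavePrimitive n := by
  rw [wavePrimitive_add_one, mul_add, ← mul_assoc, neg_one_pow_mul_self]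
  ring

lemma blockIntegral_le (n : ℕ) :
    blockIntegral n ≤ 2 * Real.pi * (((n : ℝ) + 1) * √(n + 1)) := by
  have hi (a b : ℝ) := intervalIntegrable_mul_squareWave
    (f := fun y => y * √y) (by fun_prop) a b
  have h := wavePrimitive_add_one n
  rw [wavePrimitive, wavePrimitive,
    ← intervalIntegral.integral_add_adjacent_intervals (hi 0 n) (hi n _), add_right_inj] at h
  have h2 := abs_integral_mul_squareWave_le (a := n) (b := (n + 1 : ℕ)) (by positivity)
    (by simp) (by simp)
  rw [h, abs_mul, abs_pow, abs_neg, abs_one, one_pow, one_mul] at h2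
  simpa using (le_abs_self _).trans h2

lemma signed_wavePrimitive_mem (n : ℕ) :
    0 ≤ (-1) ^ n * wavePrimitive (n + 1 : ℕ) ∧
      (-1) ^ n * wavePrimitive (n + 1 : ℕ) ≤ blockIntegral n := by
  induction n with
  | zero =>
    rw [signed_wavePrimitive_succ]
    simp [wavePrimitive_zero, blockIntegral_nonneg]
  | succ n ih =>
    rw [signed_wavePrimitive_succ, pow_succ]
    have := blockIntegral_step n
    have h0 := mul_nonneg (Real.sqrt_nonneg ((n : ℝ) + 1)) integral_squareWave_pos.le
    constructor <;> nlinarith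

lemma abs_wavePrimitive_natCast_le (n : ℕ) :
    |wavePrimitive n| ≤ 2 * Real.pi * (n * √n) := by
  cases n with
  | zero => simp [wavePrimitive_zero]
  | succ n =>
    have h := signed_wavePrimitive_mem n
    have h2 := abs_of_nonneg h.1
    rw [abs_mul, abs_pow, abs_neg, abs_one, one_pow, one_mul] at h2
    rw [h2]
    simpa using h.2.trans (blockIntegral_le n)

lemma abs_wavePrimitive_le {Y : ℝ} (hY : 0 ≤ Y) :
    |wavePrimitive Y| ≤ 4 * Real.pi * (Y * √Y) := by
  have hi (a b : ℝ) := intervalIntegrable_mul_squareWave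
    (f := fun y => y * √y) (by fun_prop) a b
  have hn := Nat.floor_le hY
  have h1 := abs_wavePrimitive_natCast_le ⌊Y⌋₊
  have h2 := abs_integral_mul_squareWave_le (Nat.cast_nonneg ⌊Y⌋₊) hn (Nat.lt_floor_add_one Y).le
  have h3 : (⌊Y⌋₊ : ℝ) * √⌊Y⌋₊ ≤ Y * √Y := by gcongr
  have h4 : wavePrimitive Y = wavePrimitive ⌊Y⌋₊ + ∫ y in (⌊Y⌋₊ : ℝ)..Y, y * √y * squareWave y :=
    (intervalIntegral.integral_add_adjacent_intervals (hi _ _) (hi _ _)).symm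
  rw [h4]
  refine (abs_add_le _ _).trans ?_
  nlinarith [Real.pi_pos]

lemma mul_sqrt_add_two_sub_le (x : ℝ) (hx : 0 ≤ x) :
    (x + 2) * √(x + 2) - x * √x ≤ 4 * √(x + 1) := by
  have hs := Real.sq_sqrt (by linarith : 0 ≤ x + 2)
  have hr := Real.sq_sqrt hx
  have hm := Real.sq_sqrt (by linarith : 0 ≤ x + 1)
  have hsr : √x ≤ √(x + 2) := Real.sqrt_le_sqrt (by linarith)
  have hr0 := Real.sqrt_nonneg x
  have hm0 := Real.sqrt_nonneg (x + 1)
  generalize √(x + 2) = s at *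
  generalize √x = r at *
  generalize √(x + 1) = m at *
  have h1 : s + r ≤ 2 * m := abs_le_of_sq_le_sq' (by nlinarith [sq_nonneg (s - r)]) (by linarith) |>.2
  have h2 : (x + 2) * s - x * r ≤ 2 * (s + r) := by
    rw [← hs, ← hr]
    have : (s - r) * (s + r) = 2 := by nlinarith
    nlinarith [mul_nonneg hr0 (sub_nonneg.2 hsr), mul_nonneg hr0 (hr0.trans hsr)]
  linarith

lemma le_signed_wavePrimitive (n : ℕ) :
    (∫ u in (0 : ℝ)..1, squareWave u) / 4 * (n * √n - 1) ≤ -((-1) ^ n * wavePrimitive n) := by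
  have hc := integral_squareWave_pos
  induction n using Nat.twoStepInduction with
  | zero =>
    simpa [wavePrimitive_zero] using by positivity
  | one =>
    have := (signed_wavePrimitive_mem 0).1
    simpa using this
  | more n ih _ =>
    have h1 := signed_wavePrimitive_succ n
    have h2 := signed_wavePrimitive_succ (n + 1)
    have h3 := blockIntegral_step n
    have h4 := mul_le_mul_of_nonneg_left (mul_sqrt_add_two_sub_le n n.cast_nonneg) hc.le
    simp only [pow_succ] at *
    push_cast at *
    rw [show (n : ℝ) + 1 + 1 = n + 2 by ring] at *
    nlinarith

lemma F1_two_pi_mul_sq {y : ℝ} (hy : 0 ≤ y) : F1 (2 * Real.pi * y ^ 2) = √y * squareWave y := by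
  have h : 2 * Real.pi * y ^ 2 / (2 * Real.pi) = y ^ 2 := by
    field_simp
  rw [F1, h, Real.sqrt_sq hy, squareWave, Real.sqrt_eq_rpow, ← Real.rpow_natCast,
    ← Real.rpow_mul hy, mul_assoc]
  norm_num

lemma image_two_pi_mul_sq {Y : ℝ} (hY : 0 ≤ Y) :
    (fun y : ℝ => 2 * Real.pi * y ^ 2) '' Set.Ioc 0 Y = Set.Ioc 0 (2 * Real.pi * Y ^ 2) := by
  have hpi := Real.pi_pos
  ext t
  constructor
  · rintro ⟨y, hy, rfl⟩
    have := hy.1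
    refine ⟨by positivity, ?_⟩
    have := hy.2
    dsimp only
    gcongr
  · intro ht
    refine ⟨√(t / (2 * Real.pi)), ⟨Real.sqrt_pos.2 (div_pos ht.1 (by positivity)), ?_⟩, ?_⟩
    · rw [Real.sqrt_le_left hY, div_le_iff₀ (by positivity), mul_comm]
      exact ht.2
    · dsimp only
      rw [Real.sq_sqrt (div_nonneg ht.1.le (by positivity))]
      field_simp

lemma integral_F1_two_pi_mul_sq {Y : ℝ} (hY : 0 ≤ Y) :
    ∫ t in (0 : ℝ)..2 * Real.pi * Y ^ 2, F1 t = 4 * Real.pi * wavePrimitive Y := by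
  have hpi := Real.pi_pos
  have hderiv (y : ℝ) : HasDerivWithinAt (fun y : ℝ => 2 * Real.pi * y ^ 2) (4 * Real.pi * y)
      (Set.Ioc 0 Y) y := by
    exact (((hasDerivAt_pow 2 y).const_mul (2 * Real.pi)).congr_deriv
      (by push_cast; ring)).hasDerivWithinAt
  have hinj : Set.InjOn (fun y : ℝ => 2 * Real.pi * y ^ 2) (Set.Ioc 0 Y) := by
    intro x hx y hy hxy
    have h : x ^ 2 = y ^ 2 := mul_left_cancel₀ (by positivity : 2 * Real.pi ≠ 0) hxy
    exact (pow_left_inj₀ hx.1.le hy.1.le two_ne_zero).1 h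
  rw [intervalIntegral.integral_of_le (by positivity), ← image_two_pi_mul_sq hY,
    integral_image_eq_integral_abs_deriv_smul (f' := fun y => 4 * Real.pi * y) measurableSet_Ioc
      (fun y _ => hderiv y) hinj, wavePrimitive, ← intervalIntegral.integral_const_mul,
    intervalIntegral.integral_of_le hY]
  refine setIntegral_congr_fun measurableSet_Ioc fun y hy => ?_
  have hy0 := hy.1
  simp only [smul_eq_mul]
  rw [F1_two_pi_mul_sq hy0.le, abs_of_pos (by positivity)]
  ring

lemma normalized_integral_F1 {Y : ℝ} (hY : 0 < Y) :
    (2 * Real.pi * Y ^ 2) ^ (-(3 : ℝ) / 4) * ∫ t in (0 : ℝ)..2 * Real.pi * Y ^ 2, F1 t =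
      (2 * Real.pi) ^ (-(3 : ℝ) / 4) * (4 * Real.pi) * (wavePrimitive Y / (Y * √Y)) := by
  have h : (Y ^ 2) ^ (-(3 : ℝ) / 4) = (Y * √Y)⁻¹ := by
    rw [Real.sqrt_eq_rpow, ← Real.rpow_one_add' hY.le (by norm_num), ← Real.rpow_neg hY.le,
      ← Real.rpow_natCast, ← Real.rpow_mul hY.le]
    norm_num
  rw [integral_F1_two_pi_mul_sq hY.le, Real.mul_rpow (by positivity) (by positivity), h]
  ring

lemma exists_abs_normalized_integral_F1_le :
    ∃ C : ℝ, ∀ᶠ T : ℝ in Filter.atTop,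
      |T ^ (-(3 : ℝ) / 4) * ∫ t in (0 : ℝ)..T, F1 t| ≤ C := by
  refine ⟨(2 * Real.pi) ^ (-(3 : ℝ) / 4) * (4 * Real.pi) * (4 * Real.pi), ?_⟩
  filter_upwards [Filter.eventually_gt_atTop 0] with T hT
  have hpi := Real.pi_pos
  have hY : 0 < √(T / (2 * Real.pi)) := Real.sqrt_pos.2 (by positivity)
  have hTY : T = 2 * Real.pi * √(T / (2 * Real.pi)) ^ 2 := by
    rw [Real.sq_sqrt (by positivity)]; field_simp
  generalize √(T / (2 * Real.pi)) = Y at hY hTY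
  subst hTY
  rw [normalized_integral_F1 hY, abs_mul, abs_of_pos (by positivity), abs_div,
    abs_of_pos (by positivity : 0 < Y * √Y)]
  gcongr
  rw [div_le_iff₀ (by positivity)]
  exact abs_wavePrimitive_le hY.le

lemma exists_le_signed_normalized_integral_F1 :
    ∃ c : ℝ, 0 < c ∧ ∀ n : ℕ, 2 ≤ n →
      c ≤ -((-1) ^ n * ((2 * Real.pi * (n : ℝ) ^ 2) ^ (-(3 : ℝ) / 4) *
        ∫ t in (0 : ℝ)..2 * Real.pi * (n : ℝ) ^ 2, F1 t)) := by
  have hc := integral_squareWave_pos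
  have hpi := Real.pi_pos
  refine ⟨(2 * Real.pi) ^ (-(3 : ℝ) / 4) * (4 * Real.pi) *
    ((∫ u in (0 : ℝ)..1, squareWave u) / 8), by positivity, fun n hn => ?_⟩
  have hn' : (2 : ℝ) ≤ n := by exact_mod_cast hn
  have hn0 : (0 : ℝ) < n := by linarith
  have hs : 1 ≤ √(n : ℝ) := Real.one_le_sqrt.2 (by linarith)
  have hns : 2 ≤ (n : ℝ) * √n := by nlinarith
  rw [normalized_integral_F1 hn0]
  have h := le_signed_wavePrimitive n
  rw [mul_left_comm ((-1 : ℝ) ^ n), ← mul_neg]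
  refine mul_le_mul_of_nonneg_left ?_ (by positivity)
  rw [← mul_div_assoc, ← neg_div, le_div_iff₀ (by positivity)]
  nlinarith

lemma tendsto_two_pi_mul_sq :
    Filter.Tendsto (fun n : ℕ => 2 * Real.pi * (n : ℝ) ^ 2) Filter.atTop Filter.atTop :=
  ((Filter.tendsto_pow_atTop two_ne_zero).comp tendsto_natCast_atTop_atTop).const_mul_atTop
    Real.two_pi_pos

theorem integral_F1_omega_pm :
    0 < Filter.atTop.limsup (fun T : ℝ => T ^ (-(3 : ℝ) / 4) * ∫ t in (0 : ℝ)..T, F1 t) ∧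
      Filter.atTop.liminf (fun T : ℝ => T ^ (-(3 : ℝ) / 4) * ∫ t in (0 : ℝ)..T, F1 t) < 0 := by
  obtain ⟨C, hC⟩ := exists_abs_normalized_integral_F1_le
  obtain ⟨c, hc, hcn⟩ := exists_le_signed_normalized_integral_F1
  constructor
  · refine hc.trans_le (Filter.le_limsup_of_frequently_le ?_
      ⟨C, Filter.eventually_map.2 (hC.mono fun T hT => (abs_le.1 hT).2)⟩)
    refine tendsto_two_pi_mul_sq.frequently (Filter.frequently_atTop.2 fun N => ?_)
    refine ⟨2 * N + 3, by lia, ?_⟩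
    have h := hcn (2 * N + 3) (by lia)
    rwa [Odd.neg_one_pow ⟨N + 1, by ring⟩, neg_one_mul, neg_neg] at h
  · refine (Filter.liminf_le_of_frequently_le (a := -c) ?_
      ⟨-C, Filter.eventually_map.2 (hC.mono fun T hT => (abs_le.1 hT).1)⟩).trans_lt
      (neg_neg_of_pos hc)
    refine tendsto_two_pi_mul_sq.frequently (Filter.frequently_atTop.2 fun N => ?_)
    refine ⟨2 * N + 2, by lia, ?_⟩
    have h := hcn (2 * N + 2) (by lia)
    rw [Even.neg_one_pow ⟨N + 1, by ring⟩, one_mul] at h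
    exact le_neg_of_le_neg h
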